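/- arXiv:1407.1604 — 2 statements merged into one kernel-verified Lean document; each statement's English description precedes it below -/
import Mathlib

section
/- (Boolean cumulants of a product.) Let k ≥ 1 and, for each i ∈ {1,…,k}, let (R^{(i)}_m)_{m≥1} be a sequence of real numbers. For n ≥ 1 define M^{(i)}_n = Σ_{π ∈ I(n)} R^{(i)}_π, the sum over all interval partitions of {1,…,n}. Then for every n ≥ 1, ∏_{i=1}^k M^{(i)}_n = Σ_{π ∈ I(n)} Q_π, where Q_m = Σ ∏_{i=1}^k R^{(i)}_{π_i}, the sum being over all k-tuples (π_1,…,π_k) of interval partitions of {1,…,m} such that the only interval partition coarser than every π_i is the one-block partition 1_m. -/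
open Finset
open scoped Classical

/-- A finpartition of `{1,…,n}` (modeled as `Fin n`) is an interval partition if each of its
blocks is an interval of consecutive integers. -/
def IsIntervalPartition {n : ℕ} (π : Finpartition (univ : Finset (Fin n))) : Prop :=
  ∀ p ∈ π.parts, ∀ i ∈ p, ∀ k ∈ p, ∀ j : Fin n, i ≤ j → j ≤ k → j ∈ p

/-- A family of interval partitions of `{1,…,n}` has join `1_n` in the lattice of interval
partitions iff the only interval partition coarser than every member of the family is the
one-block partition `1_n` (whose set of blocks is `{univ}`). -/
def IntervalJoinEqOne {n : ℕ} {ι : Type*} (π : ι → Finpartition (univ : Finset (Fin n))) :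
    Prop :=
  ∀ σ : Finpartition (univ : Finset (Fin n)),
    IsIntervalPartition σ → (∀ i, π i ≤ σ) → σ.parts = {(univ : Finset (Fin n))}

/-- The sets of block minima of interval partitions of `{0,…,n-1}`. -/
def startSets (n : ℕ) : Finset (Finset ℕ) :=
  (range n).powerset.filter fun C => 0 < n → 0 ∈ C

theorem mem_startSets {n : ℕ} {C : Finset ℕ} :
    C ∈ startSets n ↔ (∀ x ∈ C, x < n) ∧ (0 < n → 0 ∈ C) := by
  simp [startSets, subset_iff]

/-- The block starting at `x` of the interval partition of `{0,…,n-1}` with block minima `C`. -/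
def blockFrom (C : Finset ℕ) (n x : ℕ) : Finset ℕ :=
  (range n).filter fun y => x ≤ y ∧ ∀ s ∈ C, s ≤ y → s ≤ x

/-- The product of `f` over the block sizes of the interval partition of `{0,…,n-1}` with block
minima `C`. -/
def blockWeight (f : ℕ → ℝ) (n : ℕ) (C : Finset ℕ) : ℝ :=
  ∏ x ∈ C, f (blockFrom C n x).card

theorem startSets_zero : startSets 0 = {∅} := by
  ext C
  simp [mem_startSets, eq_empty_iff_forall_notMem]

theorem blockWeight_empty (f : ℕ → ℝ) (n : ℕ) : blockWeight f n ∅ = 1 := by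
  simp [blockWeight]

theorem blockWeight_singleton_zero (f : ℕ → ℝ) (n : ℕ) : blockWeight f n {0} = f n := by
  have : blockFrom {0} n 0 = range n := by
    ext y; simp [blockFrom]
  simp [blockWeight, this]

/-- The block minima of the juxtaposition of two interval partitions, the first one being of
`{0,…,j-1}`. -/
def juxtapose (j : ℕ) (A B : Finset ℕ) : Finset ℕ := A ∪ B.map (addRightEmbedding j)

theorem mem_juxtapose {j x : ℕ} {A B : Finset ℕ} :
    x ∈ juxtapose j A B ↔ x ∈ A ∨ j ≤ x ∧ x - j ∈ B := by
  simp only [juxtapose, mem_union, mem_map, addRightEmbedding_apply]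
  refine or_congr_right ⟨?_, fun h => ⟨x - j, h.2, by omega⟩⟩
  rintro ⟨a, ha, rfl⟩
  simpa using ha

theorem blockWeight_juxtapose (f : ℕ → ℝ) {j m : ℕ} {A B : Finset ℕ}
    (hA : A ∈ startSets j) (hB : B ∈ startSets m) :
    blockWeight f (j + m) (juxtapose j A B) = blockWeight f j A * blockWeight f m B := by
  rw [mem_startSets] at hA hB
  have hdisj : Disjoint A (B.map (addRightEmbedding j)) := by
    rw [disjoint_left]
    intro x hx hx'
    simp only [mem_map, addRightEmbedding_apply] at hx'
    obtain ⟨a, -, rfl⟩ := hx'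
    have := hA.1 _ hx
    omega
  have hsplit : blockWeight f (j + m) (juxtapose j A B) =
      ∏ x ∈ A ∪ B.map (addRightEmbedding j),
        f (blockFrom (juxtapose j A B) (j + m) x).card := rfl
  rw [hsplit, prod_union hdisj, prod_map]
  congr 1
  · refine prod_congr rfl fun x hx => ?_
    congr 2
    ext y
    have hxj := hA.1 x hx
    simp only [blockFrom, mem_filter, mem_range, mem_juxtapose]
    constructor
    · rintro ⟨hy, hxy, h⟩
      refine ⟨?_, hxy, fun s hs => h s (Or.inl hs)⟩
      by_contra hyj
      have := h j (Or.inr ⟨le_rfl, by simpa using hB.2 (by omega)⟩) (by omega)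
      omega
    · rintro ⟨hy, hxy, h⟩
      refine ⟨by omega, hxy, ?_⟩
      rintro s (hs | hs) hsy
      · exact h s hs hsy
      · omega
  · refine prod_congr rfl fun x hx => ?_
    congr 1
    refine Eq.trans ?_ (card_map (addRightEmbedding j))
    congr 1
    ext y
    simp only [blockFrom, mem_filter, mem_range, mem_juxtapose, mem_map,
      addRightEmbedding_apply]
    constructor
    · rintro ⟨hy, hxy, h⟩
      refine ⟨y - j, ⟨by omega, by omega, fun s hs hsy => ?_⟩, by omega⟩
      have := h (s + j) (Or.inr ⟨by omega, by simpa using hs⟩) (by omega)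
      omega
    · rintro ⟨a, ⟨ha, hxa, h⟩, rfl⟩
      refine ⟨by omega, by omega, ?_⟩
      rintro s (hs | hs) hsy
      · have := hA.1 s hs
        omega
      · have := h (s - j) hs.2 (by omega)
        omega

section Tuples

variable {ι : Type*} [Fintype ι] [DecidableEq ι]

/-- The tuples of sets of block minima whose only common element is `0`. -/
noncomputable def irreducibleTuples (ι : Type*) [Fintype ι] [DecidableEq ι] (m : ℕ) :
    Finset (ι → Finset ℕ) :=
  (Fintype.piFinset fun _ => startSets m).filter fun C => ∀ x, (∀ i, x ∈ C i) → x = 0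

theorem mem_irreducibleTuples {m : ℕ} {C : ι → Finset ℕ} :
    C ∈ irreducibleTuples ι m ↔
      (∀ i, C i ∈ startSets m) ∧ ∀ x, (∀ i, x ∈ C i) → x = 0 := by
  simp [irreducibleTuples]

theorem juxtapose_mem_startSets {j m : ℕ} (hj : 1 ≤ j) {A B : Finset ℕ}
    (hA : A ∈ startSets j) (hB : B ∈ startSets m) : juxtapose j A B ∈ startSets (j + m) := by
  rw [mem_startSets] at *
  refine ⟨fun x hx => ?_, fun _ => mem_juxtapose.2 (Or.inl (hA.2 hj))⟩
  rcases mem_juxtapose.1 hx with hx | hx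
  · have := hA.1 x hx
    omega
  · have := hB.1 _ hx.2
    omega

theorem mem_left_iff_of_juxtapose {j : ℕ} {A B : Finset ℕ} (hA : A ∈ startSets j) {x : ℕ} :
    x ∈ A ↔ x < j ∧ x ∈ juxtapose j A B := by
  rw [mem_juxtapose]
  refine ⟨fun h => ⟨(mem_startSets.1 hA).1 x h, Or.inl h⟩, ?_⟩
  rintro ⟨h, h' | h'⟩
  · exact h'
  · omega

theorem mem_right_iff_of_juxtapose {j : ℕ} {A B : Finset ℕ} (hA : A ∈ startSets j) {x : ℕ} :
    x ∈ B ↔ x + j ∈ juxtapose j A B := by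
  rw [mem_juxtapose]
  refine ⟨fun h => Or.inr ⟨by omega, by simpa using h⟩, ?_⟩
  rintro (h' | h')
  · have := (mem_startSets.1 hA).1 _ h'
    omega
  · simpa using h'.2

/-- Splitting a tuple of interval partitions at the end of the first block of its join. -/
theorem sum_prod_blockWeight_eq [Nonempty ι] (R : ι → ℕ → ℝ) {n : ℕ} (hn : 1 ≤ n) :
    ∑ C ∈ Fintype.piFinset (fun _ : ι => startSets n), ∏ i, blockWeight (R i) n (C i) =
      ∑ j ∈ Icc 1 n, (∑ A ∈ irreducibleTuples ι j, ∏ i, blockWeight (R i) j (A i)) *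
        ∑ B ∈ Fintype.piFinset (fun _ : ι => startSets (n - j)),
          ∏ i, blockWeight (R i) (n - j) (B i) := by
  simp_rw [sum_mul_sum, ← sum_product']
  rw [sum_sigma']
  symm
  refine sum_bij (fun t _ i => juxtapose t.1 (t.2.1 i) (t.2.2 i)) ?_ ?_ ?_ ?_
  · rintro ⟨j, A, B⟩ h
    simp only [mem_sigma, mem_Icc, mem_product, mem_irreducibleTuples,
      Fintype.mem_piFinset] at h ⊢
    intro i
    have := juxtapose_mem_startSets h.1.1 (h.2.1.1 i) (h.2.2 i)
    rwa [Nat.add_sub_cancel' h.1.2] at this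
  · have key : ∀ (j j' : ℕ) (A A' B B' : ι → Finset ℕ), 1 ≤ j → j' ≤ n →
        A' ∈ irreducibleTuples ι j' → (∀ i, A i ∈ startSets j) →
        (∀ i, B i ∈ startSets (n - j)) →
        (∀ i, juxtapose j (A i) (B i) = juxtapose j' (A' i) (B' i)) → j' ≤ j := by
      intro j j' A A' B B' hj hj' hA' hA hB h
      rw [mem_irreducibleTuples] at hA'
      by_contra hlt
      have := hA'.2 j fun i => by
        rw [mem_left_iff_of_juxtapose (hA'.1 i) (B := B' i), ← h i]
        refine ⟨by omega, mem_juxtapose.2 (Or.inr ⟨le_rfl, ?_⟩)⟩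
        simpa using (mem_startSets.1 (hB i)).2 (by omega)
      omega
    rintro ⟨j, A, B⟩ h ⟨j', A', B'⟩ h' heq
    simp only [mem_sigma, mem_Icc, mem_product, Fintype.mem_piFinset] at h h'
    have heq' : ∀ i, juxtapose j (A i) (B i) = juxtapose j' (A' i) (B' i) := congrFun heq
    have hA := mem_irreducibleTuples.1 h.2.1
    have hA' := mem_irreducibleTuples.1 h'.2.1
    obtain rfl : j = j' := le_antisymm
      (key _ _ _ _ _ _ h'.1.1 h.1.2 h.2.1 hA'.1 h'.2.2 fun i => (heq' i).symm)
      (key _ _ _ _ _ _ h.1.1 h'.1.2 h'.2.1 hA.1 h.2.2 heq')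
    obtain rfl : A = A' := by
      ext i x
      rw [mem_left_iff_of_juxtapose (hA.1 i) (B := B i), heq' i,
        ← mem_left_iff_of_juxtapose (hA'.1 i)]
    obtain rfl : B = B' := by
      ext i x
      rw [mem_right_iff_of_juxtapose (hA.1 i), heq' i, ← mem_right_iff_of_juxtapose (hA.1 i)]
    rfl
  · intro C hC
    simp only [Fintype.mem_piFinset, mem_startSets] at hC
    have hex : ∃ j, 1 ≤ j ∧ (j = n ∨ ∀ i, j ∈ C i) := ⟨n, hn, Or.inl rfl⟩
    obtain ⟨hj1, hj⟩ := Nat.find_spec hex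
    have hmin := fun m => @Nat.find_min _ _ hex m
    have hjn : Nat.find hex ≤ n := Nat.find_min' hex ⟨hn, Or.inl rfl⟩
    generalize Nat.find hex = j at hj1 hj hmin hjn
    refine ⟨⟨j, fun i => (C i).filter (· < j),
      fun i => (range (n - j)).filter (· + j ∈ C i)⟩, ?_, ?_⟩
    · simp only [mem_sigma, mem_Icc, mem_product, mem_irreducibleTuples,
        Fintype.mem_piFinset, mem_startSets, mem_filter, mem_range]
      refine ⟨⟨hj1, hjn⟩, ⟨fun i => ⟨fun x hx => hx.2, fun h => ⟨(hC i).2 hn, h⟩⟩, ?_⟩,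
        fun i => ⟨fun x hx => hx.1, fun h => ⟨h, ?_⟩⟩⟩
      · intro x hx
        by_contra hx0
        obtain ⟨i⟩ := ‹Nonempty ι›
        exact hmin x (hx i).2 ⟨by omega, Or.inr fun i => (hx i).1⟩
      · rcases hj with hj | hj
        · omega
        · simpa using hj i
    · funext i
      ext x
      simp only [mem_juxtapose, mem_filter, mem_range]
      constructor
      · rintro (h | ⟨h, -, h'⟩)
        · exact h.1
        · rwa [Nat.sub_add_cancel h] at h'
      · intro h
        have := (hC i).1 x h
        by_cases hxj : x < j
        · exact Or.inl ⟨h, hxj⟩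
        · refine Or.inr ⟨by omega, by omega, ?_⟩
          rwa [Nat.sub_add_cancel (by omega)]
  · rintro ⟨j, A, B⟩ h
    simp only [mem_sigma, mem_Icc, mem_product, mem_irreducibleTuples,
      Fintype.mem_piFinset] at h
    rw [← prod_mul_distrib]
    refine prod_congr rfl fun i _ => ?_
    rw [← blockWeight_juxtapose _ (h.2.1.1 i) (h.2.2 i), Nat.add_sub_cancel' h.1.2]

theorem sum_blockWeight_eq (f : ℕ → ℝ) {n : ℕ} (hn : 1 ≤ n) :
    ∑ C ∈ startSets n, blockWeight f n C =
      ∑ j ∈ Icc 1 n, f j * ∑ B ∈ startSets (n - j), blockWeight f (n - j) B := by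
  have hpi : ∀ m, ∑ C ∈ Fintype.piFinset (fun _ : Unit => startSets m),
      ∏ i, blockWeight f m (C i) = ∑ C ∈ startSets m, blockWeight f m C := by
    intro m
    rw [← prod_univ_sum (fun _ : Unit => startSets m) fun _ C => blockWeight f m C]
    simp
  have h := sum_prod_blockWeight_eq (fun _ : Unit => f) hn
  simp_rw [hpi] at h
  rw [h]
  refine sum_congr rfl fun j hj => ?_
  have hj1 := (mem_Icc.1 hj).1
  have : irreducibleTuples Unit j = {fun _ => {0}} := by
    ext C
    simp only [mem_irreducibleTuples, mem_singleton, mem_startSets, Unique.forall_iff]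
    constructor
    · rintro ⟨⟨-, h0⟩, h⟩
      funext i
      ext x
      rw [mem_singleton]
      exact ⟨h x, fun hx => hx ▸ h0 hj1⟩
    · rintro rfl
      simpa using Nat.pos_of_ne_zero (by omega)
  simp [this, blockWeight_singleton_zero]

/-- The combinatorial core, in terms of sets of block minima. -/
theorem prod_sum_blockWeight [Nonempty ι] (R : ι → ℕ → ℝ) (Q : ℕ → ℝ)
    (hQ : ∀ m, 1 ≤ m → Q m = ∑ A ∈ irreducibleTuples ι m, ∏ i, blockWeight (R i) m (A i))
    (n : ℕ) :
    ∏ i, ∑ C ∈ startSets n, blockWeight (R i) n C = ∑ C ∈ startSets n, blockWeight Q n C := by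
  induction n using Nat.strong_induction_on with
  | _ n ih =>
    rcases Nat.eq_zero_or_pos n with rfl | hn
    · simp [startSets_zero, blockWeight_empty]
    · rw [prod_univ_sum, sum_prod_blockWeight_eq R hn, sum_blockWeight_eq Q hn]
      refine sum_congr rfl fun j hj => ?_
      rw [mem_Icc] at hj
      rw [← hQ j hj.1, ← ih (n - j) (by omega), prod_univ_sum]

end Tuples

/-- The interval partition of `Fin n` with set of block minima `C`. -/
noncomputable def partitionOfStarts (n : ℕ) (C : Finset ℕ) :
    Finpartition (univ : Finset (Fin n)) :=
  Finpartition.ofSetoid (Setoid.ker fun y : Fin n => C.filter (· ≤ (y : ℕ)))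

theorem mem_part_partitionOfStarts {n : ℕ} {C : Finset ℕ} {x y : Fin n} :
    y ∈ (partitionOfStarts n C).part x ↔
      C.filter (· ≤ (x : ℕ)) = C.filter (· ≤ (y : ℕ)) := by
  rw [partitionOfStarts, Finpartition.mem_part_ofSetoid_iff_rel, Setoid.ker_def]

theorem le_iff_part_subset {n : ℕ} {π σ : Finpartition (univ : Finset (Fin n))} :
    π ≤ σ ↔ ∀ x, π.part x ⊆ σ.part x := by
  constructor
  · intro h x
    obtain ⟨c, hc, hle⟩ := h (π.part_mem.2 (mem_univ x))
    rwa [σ.part_eq_of_mem hc (hle (π.mem_part (mem_univ x)))]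
  · intro h p hp
    obtain ⟨x, hx⟩ := π.nonempty_of_mem_parts hp
    refine ⟨σ.part x, σ.part_mem.2 (mem_univ x), ?_⟩
    rw [← π.part_eq_of_mem hp hx]
    exact h x

theorem isIntervalPartition_iff {n : ℕ} {π : Finpartition (univ : Finset (Fin n))} :
    IsIntervalPartition π ↔
      ∀ x z, z ∈ π.part x → ∀ y, x ≤ y → y ≤ z → y ∈ π.part x := by
  constructor
  · intro h x z hz y hxy hyz
    exact h _ (π.part_mem.2 (mem_univ x)) x (π.mem_part (mem_univ x)) z hz y hxy hyz
  · intro h p hp x hx z hz y hxy hyz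
    rw [← π.part_eq_of_mem hp hx] at hz ⊢
    exact h x z hz y hxy hyz

theorem isIntervalPartition_partitionOfStarts (n : ℕ) (C : Finset ℕ) :
    IsIntervalPartition (partitionOfStarts n C) := by
  rw [isIntervalPartition_iff]
  intro x z hz y hxy hyz
  rw [mem_part_partitionOfStarts] at hz ⊢
  have hxy' : (x : ℕ) ≤ y := hxy
  have hyz' : (y : ℕ) ≤ z := hyz
  ext s
  have := congrArg (s ∈ ·) hz
  simp only [mem_filter, eq_iff_iff] at this ⊢
  grind

theorem partitionOfStarts_le_iff {n : ℕ} {C D : Finset ℕ} (hC : C ∈ startSets n)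
    (hD : D ∈ startSets n) : partitionOfStarts n C ≤ partitionOfStarts n D ↔ D ⊆ C := by
  rw [mem_startSets] at hC hD
  rw [le_iff_part_subset]
  constructor
  · intro h x hx
    by_contra hxC
    have hxn := hD.1 x hx
    have hx0 : x ≠ 0 := by
      rintro rfl
      exact hxC (hC.2 hxn)
    have h1 : (⟨x, hxn⟩ : Fin n) ∈ (partitionOfStarts n C).part ⟨x - 1, by omega⟩ := by
      rw [mem_part_partitionOfStarts]
      ext s
      simp only [mem_filter]
      refine and_congr_right fun hs => ?_
      have : s ≠ x := fun h => hxC (h ▸ hs)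
      omega
    have h2 := congrArg (x ∈ ·) (mem_part_partitionOfStarts.1 (h _ h1))
    simp only [mem_filter, eq_iff_iff, hx, true_and, le_refl, iff_true] at h2
    omega
  · intro h x y hy
    rw [mem_part_partitionOfStarts] at hy ⊢
    ext s
    have := congrArg (s ∈ ·) hy
    simp only [mem_filter, eq_iff_iff] at this ⊢
    have := @h s
    tauto

theorem exists_partitionOfStarts_eq {n : ℕ} {π : Finpartition (univ : Finset (Fin n))}
    (hπ : IsIntervalPartition π) : ∃ C ∈ startSets n, partitionOfStarts n C = π := by
  rw [isIntervalPartition_iff] at hπ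
  have hsymm : ∀ {x y : Fin n}, y ∈ π.part x → π.part y = π.part x := fun {x y} h =>
    π.part_eq_of_mem (π.part_mem.2 (mem_univ x)) h
  have hself : ∀ x : Fin n, x ∈ π.part x := fun x => π.mem_part (mem_univ x)
  let S : Finset (Fin n) := univ.filter fun x => ∀ y ∈ π.part x, x ≤ y
  let C : Finset ℕ := S.map Fin.valEmbedding
  have hmem : ∀ x : Fin n, (x : ℕ) ∈ C ↔ ∀ y ∈ π.part x, x ≤ y := by
    intro x
    simp [C, S, Fin.val_inj]
  have hlt : ∀ x ∈ C, x < n := by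
    intro x hx
    obtain ⟨a, -, rfl⟩ := mem_map.1 hx
    exact a.2
  refine ⟨C, mem_startSets.2 ⟨hlt, fun h => (hmem ⟨0, h⟩).2 fun y _ => Nat.zero_le _⟩, ?_⟩
  have forward : ∀ x y : Fin n, x ≤ y → y ∈ π.part x →
      C.filter (· ≤ (x : ℕ)) = C.filter (· ≤ (y : ℕ)) := by
    intro x y hxy hy
    have hxy' : (x : ℕ) ≤ y := hxy
    ext s
    simp only [mem_filter]
    refine and_congr_right fun hs => ⟨fun h => by omega, fun hsy => ?_⟩
    by_contra hsx
    have hsn := hlt s hs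
    have h1 : (⟨s, hsn⟩ : Fin n) ∈ π.part x :=
      hπ x y hy _ (Fin.le_def.2 (by simp; omega)) hsy
    have h2 := (hmem ⟨s, hsn⟩).1 hs x (by rw [hsymm h1]; exact hself x)
    exact hsx h2
  have backward : ∀ x y : Fin n, x ≤ y →
      C.filter (· ≤ (x : ℕ)) = C.filter (· ≤ (y : ℕ)) → y ∈ π.part x := by
    intro x y hxy h
    obtain ⟨m, hm, hmin⟩ := (π.part y).exists_min_image id ⟨y, hself y⟩
    have hmC : (m : ℕ) ∈ C := (hmem m).2 (by rw [hsymm hm]; exact hmin)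
    have hmy : (m : ℕ) ≤ y := hmin y (hself y)
    have hmx := congrArg ((m : ℕ) ∈ ·) h
    simp only [mem_filter, hmC, hmy, true_and, eq_iff_iff, iff_true] at hmx
    have hx : x ∈ π.part m := hπ m y (by rw [hsymm hm]; exact hself y) x hmx hxy
    rw [hsymm hx, hsymm hm]
    exact hself y
  refine le_antisymm (le_iff_part_subset.2 fun x y hy => ?_)
    (le_iff_part_subset.2 fun x y hy => ?_)
  · rw [mem_part_partitionOfStarts] at hy
    rcases le_total x y with h | h
    · exact backward x y h hy
    · have := hsymm (backward y x h hy.symm)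
      rw [this]
      exact hself y
  · rw [mem_part_partitionOfStarts]
    rcases le_total x y with h | h
    · exact forward x y h hy
    · exact (forward y x h (by rw [hsymm hy]; exact hself x)).symm

theorem prod_parts_partitionOfStarts (f : ℕ → ℝ) {n : ℕ} {C : Finset ℕ}
    (hC : C ∈ startSets n) :
    ∏ p ∈ (partitionOfStarts n C).parts, f p.card = blockWeight f n C := by
  rw [mem_startSets] at hC
  symm
  refine prod_bij (fun x hx => (partitionOfStarts n C).part ⟨x, hC.1 x hx⟩) ?_ ?_ ?_ ?_
  · intro x hx
    exact (partitionOfStarts n C).part_mem.2 (mem_univ _)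
  · intro x hx y hy h
    have h1 : (⟨y, hC.1 y hy⟩ : Fin n) ∈ (partitionOfStarts n C).part ⟨x, hC.1 x hx⟩ := by
      rw [h]
      exact (partitionOfStarts n C).mem_part (mem_univ _)
    rw [mem_part_partitionOfStarts] at h1
    have hx' := congrArg (x ∈ ·) h1
    have hy' := congrArg (y ∈ ·) h1
    simp only [mem_filter, eq_iff_iff, hx, hy, true_and, le_refl, true_iff, iff_true] at hx' hy'
    omega
  · intro p hp
    obtain ⟨y, hy⟩ := (partitionOfStarts n C).nonempty_of_mem_parts hp
    have hne : (C.filter (· ≤ (y : ℕ))).Nonempty :=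
      ⟨0, mem_filter.2 ⟨hC.2 (by have := y.2; omega), Nat.zero_le _⟩⟩
    obtain ⟨m, hm, hmax⟩ := exists_max_image _ id hne
    have hm' := mem_filter.1 hm
    refine ⟨m, hm'.1, ?_⟩
    have : y ∈ (partitionOfStarts n C).part ⟨m, hC.1 m hm'.1⟩ := by
      rw [mem_part_partitionOfStarts]
      ext s
      simp only [mem_filter]
      refine and_congr_right fun hs => ⟨fun h => h.trans hm'.2, fun h => ?_⟩
      exact hmax s (mem_filter.2 ⟨hs, h⟩)
    rw [← (partitionOfStarts n C).part_eq_of_mem hp hy]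
    exact ((partitionOfStarts n C).part_eq_of_mem
      ((partitionOfStarts n C).part_mem.2 (mem_univ _)) this).symm
  · intro x hx
    congr 1
    rw [← card_map Fin.valEmbedding]
    congr 1
    ext y
    simp only [blockFrom, mem_filter, mem_range, mem_map, mem_part_partitionOfStarts]
    constructor
    · rintro ⟨hy, hxy, h⟩
      refine ⟨⟨y, hy⟩, ?_, rfl⟩
      ext s
      simp only [mem_filter]
      exact and_congr_right fun hs => ⟨fun h => h.trans hxy, h s hs⟩
    · rintro ⟨a, ha, rfl⟩
      have hmem : ∀ s ∈ C, s ≤ x ↔ s ≤ a := by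
        intro s hs
        have := congrArg (s ∈ ·) ha
        simpa [hs] using this
      exact ⟨a.2, (hmem x hx).1 le_rfl, fun s hs => (hmem s hs).2⟩

theorem intervalJoinEqOne_partitionOfStarts_iff {ι : Type*} [Nonempty ι] {n : ℕ} (hn : 1 ≤ n)
    {C : ι → Finset ℕ} (hC : ∀ i, C i ∈ startSets n) :
    IntervalJoinEqOne (fun i => partitionOfStarts n (C i)) ↔
      ∀ x, (∀ i, x ∈ C i) → x = 0 := by
  constructor
  · intro h x hx
    let D := (range n).filter fun y => ∀ i, y ∈ C i
    have hD : D ∈ startSets n := mem_startSets.2 ⟨fun y hy => mem_range.1 (mem_filter.1 hy).1,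
      fun h0 => mem_filter.2 ⟨mem_range.2 h0, fun i => (mem_startSets.1 (hC i)).2 h0⟩⟩
    have hparts := h (partitionOfStarts n D) (isIntervalPartition_partitionOfStarts n D)
      fun i => (partitionOfStarts_le_iff (hC i) hD).2 fun y hy => (mem_filter.1 hy).2 i
    obtain ⟨i⟩ := ‹Nonempty ι›
    have hxn := (mem_startSets.1 (hC i)).1 x (hx i)
    have hpart : (⟨x, hxn⟩ : Fin n) ∈ (partitionOfStarts n D).part ⟨0, hn⟩ := by
      rw [(partitionOfStarts n D).part_eq_of_mem (hparts ▸ mem_singleton_self _) (mem_univ _)]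
      exact mem_univ _
    rw [mem_part_partitionOfStarts] at hpart
    have hxD : x ∈ D.filter (· ≤ x) :=
      mem_filter.2 ⟨mem_filter.2 ⟨mem_range.2 hxn, hx⟩, le_rfl⟩
    rw [← hpart] at hxD
    exact Nat.le_zero.1 (mem_filter.1 hxD).2
  · intro h σ hσ hle
    obtain ⟨D, hD, rfl⟩ := exists_partitionOfStarts_eq hσ
    have hD0 : ∀ x ∈ D, x = 0 := fun x hx =>
      h x fun i => (partitionOfStarts_le_iff (hC i) hD).1 (hle i) hx
    have hpart : ∀ x, (partitionOfStarts n D).part x = univ := by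
      intro x
      refine eq_univ_of_forall fun y => mem_part_partitionOfStarts.2 ?_
      ext s
      simp only [mem_filter]
      refine and_congr_right fun hs => ?_
      simp [hD0 s hs]
    ext p
    rw [mem_singleton]
    constructor
    · intro hp
      obtain ⟨y, hy⟩ := (partitionOfStarts n D).nonempty_of_mem_parts hp
      rw [← (partitionOfStarts n D).part_eq_of_mem hp hy, hpart]
    · rintro rfl
      have := (partitionOfStarts n D).part_mem.2 (mem_univ (⟨0, hn⟩ : Fin n))
      rwa [hpart] at this

theorem partitionOfStarts_injOn (n : ℕ) :
    Set.InjOn (partitionOfStarts n) (startSets n : Set (Finset ℕ)) := fun _ hC _ hD h =>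
  subset_antisymm ((partitionOfStarts_le_iff hD hC).1 h.ge)
    ((partitionOfStarts_le_iff hC hD).1 h.le)

theorem sum_isIntervalPartition (f : ℕ → ℝ) (n : ℕ) :
    ∑ π ∈ (univ : Finset (Finpartition (univ : Finset (Fin n)))).filter IsIntervalPartition,
      ∏ p ∈ π.parts, f p.card = ∑ C ∈ startSets n, blockWeight f n C := by
  symm
  refine sum_bij (fun C _ => partitionOfStarts n C) ?_ ?_ ?_ ?_
  · intro C _
    exact mem_filter.2 ⟨mem_univ _, isIntervalPartition_partitionOfStarts n C⟩
  · intro C hC D hD h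
    exact partitionOfStarts_injOn n hC hD h
  · intro π hπ
    obtain ⟨C, hC, rfl⟩ := exists_partitionOfStarts_eq (mem_filter.1 hπ).2
    exact ⟨C, hC, rfl⟩
  · intro C hC
    exact (prod_parts_partitionOfStarts f hC).symm

theorem sum_intervalJoinEqOne {ι : Type*} [Fintype ι] [DecidableEq ι] [Nonempty ι]
    (R : ι → ℕ → ℝ) {m : ℕ} (hm : 1 ≤ m) :
    ∑ π ∈ (univ : Finset (ι → Finpartition (univ : Finset (Fin m)))).filter
        (fun π => (∀ i, IsIntervalPartition (π i)) ∧ IntervalJoinEqOne π),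
      ∏ i, ∏ p ∈ (π i).parts, R i p.card =
    ∑ A ∈ irreducibleTuples ι m, ∏ i, blockWeight (R i) m (A i) := by
  symm
  refine sum_bij (fun A _ i => partitionOfStarts m (A i)) ?_ ?_ ?_ ?_
  · intro A hA
    rw [mem_irreducibleTuples] at hA
    exact mem_filter.2 ⟨mem_univ _, fun i => isIntervalPartition_partitionOfStarts m (A i),
      (intervalJoinEqOne_partitionOfStarts_iff hm hA.1).2 hA.2⟩
  · intro A hA B hB h
    rw [mem_irreducibleTuples] at hA hB
    exact funext fun i => partitionOfStarts_injOn m (hA.1 i) (hB.1 i) (congrFun h i)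
  · intro π hπ
    obtain ⟨-, hint, hjoin⟩ := mem_filter.1 hπ
    choose A hA hAπ using fun i => exists_partitionOfStarts_eq (hint i)
    obtain rfl : (fun i => partitionOfStarts m (A i)) = π := funext hAπ
    exact ⟨A, mem_irreducibleTuples.2
      ⟨hA, (intervalJoinEqOne_partitionOfStarts_iff hm hA).1 hjoin⟩, rfl⟩
  · intro A hA
    rw [mem_irreducibleTuples] at hA
    exact prod_congr rfl fun i _ => (prod_parts_partitionOfStarts (R i) (hA.1 i)).symm

/-- **Boolean cumulants of a product.**  If, for each `i`, `(R i m)_{m ≥ 1}` is the Boolean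
cumulant sequence of the moments `(M i n)_{n ≥ 1}` (i.e. `M i n = ∑_{π ∈ I(n)} ∏_{p ∈ π} R i |p|`,
summing over interval partitions), then the Boolean cumulant sequence of the product moment
sequence `(∏ i, M i n)_{n ≥ 1}` is `Q m = ∑_{π₁ ∨ ⋯ ∨ π_k = 1_m in I(m)} ∏ i, R i (π i)`. -/
theorem booleanCumulants_of_product (k : ℕ) (hk : 1 ≤ k) (R : Fin k → ℕ → ℝ)
    (M : Fin k → ℕ → ℝ)
    (hM : ∀ i : Fin k, ∀ n : ℕ, 1 ≤ n →
      M i n = ∑ π ∈ (univ : Finset (Finpartition (univ : Finset (Fin n)))).filter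
          IsIntervalPartition, ∏ p ∈ π.parts, R i p.card)
    (Q : ℕ → ℝ)
    (hQ : ∀ m : ℕ, 1 ≤ m →
      Q m = ∑ π ∈ (univ : Finset (Fin k → Finpartition (univ : Finset (Fin m)))).filter
          (fun π => (∀ i, IsIntervalPartition (π i)) ∧ IntervalJoinEqOne π),
        ∏ i, ∏ p ∈ (π i).parts, R i p.card)
    (n : ℕ) (hn : 1 ≤ n) :
    (∏ i, M i n) = ∑ π ∈ (univ : Finset (Finpartition (univ : Finset (Fin n)))).filter
        IsIntervalPartition, ∏ p ∈ π.parts, Q p.card := by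
  have : Nonempty (Fin k) := ⟨⟨0, hk⟩⟩
  rw [sum_isIntervalPartition, prod_congr rfl fun i _ => (hM i n hn).trans
    (sum_isIntervalPartition (R i) n)]
  exact prod_sum_blockWeight R Q (fun m hm => (hQ m hm).trans (by
    convert sum_intervalJoinEqOne R hm)) n
end

section
/- For k ≥ 1, let a_{n,k} = Σ_{π ∈ NC(n)} p_k(π) be the total number of blocks of size k over all noncrossing partitions of {1,…,n}, and let C(z) = Σ_{n≥0} Cat_n z^n be the generating series of the Catalan numbers. Then as formal power series over ℚ, (2 − C(z)) · Σ_{n≥k} a_{n,k} z^n = z^k C(z)^k. -/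
open Finset PowerSeries
open scoped Classical

/-- A finpartition of `{1,…,n}` (modeled as `Fin n`) is noncrossing if there are no
indices `i < j < k < l` with `i, k` in one block and `j, l` in a different block. -/
def IsNoncrossing {n : ℕ} (π : Finpartition (univ : Finset (Fin n))) : Prop :=
  ∀ p ∈ π.parts, ∀ q ∈ π.parts, ∀ i j k l : Fin n,
    i < j → j < k → k < l → i ∈ p → k ∈ p → j ∈ q → l ∈ q → p = q

/-- `a n k` is the total number of blocks of size `k` counted over all noncrossing
partitions of `{1,…,n}`. -/
noncomputable def blockCount (n k : ℕ) : ℕ :=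
  ∑ π ∈ (univ : Finset (Finpartition (univ : Finset (Fin n)))).filter IsNoncrossing,
    (π.parts.filter fun p => p.card = k).card

/-- A noncrossing partial equivalence relation on `ℕ` whose domain is the interval `[a, b)`. -/
structure IsNoncrossingRel (a b : ℕ) (r : ℕ → ℕ → Prop) : Prop where
  symm : ∀ x y, r x y → r y x
  trans : ∀ x y z, r x y → r y z → r x z
  dom : ∀ x, r x x ↔ a ≤ x ∧ x < b
  noncrossing : ∀ i j k l, i < j → j < k → k < l → r i k → r j l → r i j

/-- The union of `σ` and `τ`, with the new element `a` joined to the class of `m` in `τ`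
(and forming a singleton class if `m` is not in the domain of `τ`). -/
def glueRel (a m : ℕ) (σ τ : ℕ → ℕ → Prop) (x y : ℕ) : Prop :=
  σ x y ∨ τ x y ∨ (x = a ∧ (y = a ∨ τ m y)) ∨ (y = a ∧ τ x m)

namespace IsNoncrossingRel

variable {a b m : ℕ} {r σ τ : ℕ → ℕ → Prop}

theorem left_mem (h : IsNoncrossingRel a b r) {x y : ℕ} (hxy : r x y) : a ≤ x ∧ x < b :=
  (h.dom x).1 (h.trans x y x hxy (h.symm x y hxy))

theorem right_mem (h : IsNoncrossingRel a b r) {x y : ℕ} (hxy : r x y) : a ≤ y ∧ y < b :=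
  h.left_mem (h.symm x y hxy)

theorem glue (hσ : IsNoncrossingRel (a + 1) m σ) (hτ : IsNoncrossingRel m b τ)
    (ham : a < m) (hmb : m ≤ b) : IsNoncrossingRel a b (glueRel a m σ τ) := by
  have h1 := fun x y => @left_mem _ _ _ hσ x y
  have h2 := fun x y => @right_mem _ _ _ hσ x y
  have h3 := fun x y => @left_mem _ _ _ hτ x y
  have h4 := fun x y => @right_mem _ _ _ hτ x y
  obtain ⟨s1, t1, d1, n1⟩ := hσ
  obtain ⟨s2, t2, d2, n2⟩ := hτ
  constructor
  · intro x y h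
    unfold glueRel at *
    grind
  · intro x y z h h'
    unfold glueRel at *
    grind
  · intro x
    unfold glueRel
    grind
  · intro i j k l hij hjk hkl h h'
    unfold glueRel at *
    grind

theorem restrict (h : IsNoncrossingRel a b r) {c d : ℕ} (hc : a ≤ c) (hd : d ≤ b) :
    IsNoncrossingRel c d fun x y => r x y ∧ (c ≤ x ∧ x < d) ∧ (c ≤ y ∧ y < d) := by
  obtain ⟨s1, t1, d1, n1⟩ := h
  constructor
  · grind
  · grind
  · grind
  · intro i j k l hij hjk hkl h h'
    exact ⟨n1 i j k l hij hjk hkl h.1 h'.1, by grind⟩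

theorem glueRel_iff_left (hτ : IsNoncrossingRel m b τ)
    {x y : ℕ} (hx : a < x ∧ x < m) : glueRel a m σ τ x y ↔ σ x y := by
  have h3 := @left_mem _ _ _ hτ x y
  have h4 := @left_mem _ _ _ hτ x m
  unfold glueRel
  grind

theorem glueRel_iff_right (hσ : IsNoncrossingRel (a + 1) m σ) (ham : a < m)
    {x y : ℕ} (hx : m ≤ x) (hy : m ≤ y) : glueRel a m σ τ x y ↔ τ x y := by
  have h3 := @left_mem _ _ _ hσ x y
  unfold glueRel
  grind

theorem glueRel_base_iff (hσ : IsNoncrossingRel (a + 1) m σ) (hτ : IsNoncrossingRel m b τ)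
    (ham : a < m) {y : ℕ} : glueRel a m σ τ a y ↔ y = a ∨ τ m y := by
  have h3 := @left_mem _ _ _ hσ a y
  have h4 := @left_mem _ _ _ hτ a y
  have h5 := @left_mem _ _ _ hτ a m
  unfold glueRel
  grind

theorem exists_eq_glueRel (h : IsNoncrossingRel a b r) (hab : a < b) :
    ∃ m σ τ, a < m ∧ m ≤ b ∧ IsNoncrossingRel (a + 1) m σ ∧ IsNoncrossingRel m b τ ∧
      r = glueRel a m σ τ := by
  obtain ⟨m, ham, hmb, hlt, hm⟩ : ∃ m, a < m ∧ m ≤ b ∧ (∀ y, a < y → y < m → ¬ r a y) ∧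
      (m < b → r a m) := by
    by_cases hex : ∃ y, a < y ∧ r a y
    · let : DecidablePred fun y => a < y ∧ r a y := Classical.decPred _
      refine ⟨Nat.find hex, (Nat.find_spec hex).1, (h.right_mem (Nat.find_spec hex).2).2.le, ?_,
        fun _ => (Nat.find_spec hex).2⟩
      intro y hy hym hr
      exact Nat.find_min hex hym ⟨hy, hr⟩
    · exact ⟨b, hab, le_rfl, fun y hy _ hr => hex ⟨y, hy, hr⟩, fun hb => absurd hb (lt_irrefl b)⟩
  refine ⟨m, _, _, ham, hmb, h.restrict (c := a + 1) (d := m) (by omega) hmb,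
    h.restrict (c := m) (d := b) ham.le le_rfl, ?_⟩
  have hl := fun x y => @left_mem _ _ _ h x y
  have hr := fun x y => @right_mem _ _ _ h x y
  obtain ⟨s1, t1, d1, n1⟩ := h
  have cross : ∀ x y, a < x → x < m → m ≤ y → ¬ r x y := by
    intro x y hx hxm hy hxy
    have := hr x y hxy
    have ham' := hm (by omega)
    rcases hy.eq_or_lt with rfl | hy
    · exact hlt x hx hxm (t1 _ _ _ ham' (s1 _ _ hxy))
    · exact hlt x hx hxm (n1 a x m y hx hxm hy ham' hxy)
  funext x y
  unfold glueRel
  grind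

end IsNoncrossingRel

open BinaryTree

/-- The noncrossing relation on `[a, a + t.numNodes)` encoded by a binary tree: the root is the
least element, its left subtree encodes the elements strictly between the root and the next element
of its class, and its right subtree encodes the remaining elements. -/
def BinaryTree.ncRel : BinaryTree Unit → ℕ → ℕ → ℕ → Prop
  | .nil, _ => fun _ _ => False
  | .node _ l r, a =>
    glueRel a (a + 1 + l.numNodes) (l.ncRel (a + 1)) (r.ncRel (a + 1 + l.numNodes))

theorem BinaryTree.ncRel_nil (a : ℕ) : (nil : BinaryTree Unit).ncRel a = fun _ _ => False := rfl

theorem BinaryTree.ncRel_node (u : Unit) (l r : BinaryTree Unit) (a : ℕ) :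
    (node u l r).ncRel a =
      glueRel a (a + 1 + l.numNodes) (l.ncRel (a + 1)) (r.ncRel (a + 1 + l.numNodes)) := rfl

theorem BinaryTree.isNoncrossingRel_ncRel (t : BinaryTree Unit) (a : ℕ) :
    IsNoncrossingRel a (a + t.numNodes) (t.ncRel a) := by
  induction t generalizing a with
  | nil => constructor <;> simp [ncRel]
  | node u l r ihl ihr =>
    have h := (ihl (a + 1)).glue (ihr (a + 1 + l.numNodes)) (by omega) (by omega)
    rwa [show a + 1 + l.numNodes + r.numNodes = a + (node u l r).numNodes by
      simp only [numNodes]; omega] at h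

theorem BinaryTree.ncRel_injective (t t' : BinaryTree Unit) (a : ℕ)
    (h : t.ncRel a = t'.ncRel a) : t = t' := by
  induction t generalizing a t' with
  | nil =>
    cases t' with
    | nil => rfl
    | node _ l r =>
      have := congrFun (congrFun h a) a
      simp [ncRel, glueRel] at this
  | node u l r ihl ihr =>
    cases t' with
    | nil =>
      have := congrFun (congrFun h a) a
      simp [ncRel, glueRel] at this
    | node u' l' r' =>
      have hb : ∀ x, (a ≤ x ∧ x < a + (node u l r).numNodes) ↔
          (a ≤ x ∧ x < a + (node u' l' r').numNodes) := fun x => by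
        rw [← ((node u l r).isNoncrossingRel_ncRel a).dom x, h,
          ((node u' l' r').isNoncrossingRel_ncRel a).dom x]
      have hl := l.isNoncrossingRel_ncRel (a + 1)
      have hr := r.isNoncrossingRel_ncRel (a + 1 + l.numNodes)
      have hl' := l'.isNoncrossingRel_ncRel (a + 1)
      have hr' := r'.isNoncrossingRel_ncRel (a + 1 + l'.numNodes)
      simp only [numNodes] at hb
      have hb1 := hb (a + l.numNodes + r.numNodes)
      have hb2 := hb (a + l'.numNodes + r'.numNodes)
      simp only [ncRel] at h
      have key : ∀ y, (y = a ∨ r.ncRel (a + 1 + l.numNodes) (a + 1 + l.numNodes) y) ↔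
          (y = a ∨ r'.ncRel (a + 1 + l'.numNodes) (a + 1 + l'.numNodes) y) := fun y => by
        rw [← hl.glueRel_base_iff hr (by omega), h, hl'.glueRel_base_iff hr' (by omega)]
      have hm : l.numNodes = l'.numNodes := by
        have k1 := key (a + 1 + l.numNodes)
        have k2 := key (a + 1 + l'.numNodes)
        have d1 := hr.dom (a + 1 + l.numNodes)
        have d2 := hr'.dom (a + 1 + l'.numNodes)
        have m1 := @IsNoncrossingRel.right_mem _ _ _ hr
          (a + 1 + l.numNodes) (a + 1 + l'.numNodes)
        have m2 := @IsNoncrossingRel.right_mem _ _ _ hr'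
          (a + 1 + l'.numNodes) (a + 1 + l.numNodes)
        grind
      rw [← hm] at h hr' hl'
      have e1 : l = l' := by
        refine ihl l' (a + 1) ?_
        funext x y
        by_cases hx : a < x ∧ x < a + 1 + l.numNodes
        · rw [← hr.glueRel_iff_left (σ := l.ncRel (a + 1)) hx, h, hr'.glueRel_iff_left hx]
        · have m1 := @IsNoncrossingRel.left_mem _ _ _ hl x y
          have m2 := @IsNoncrossingRel.left_mem _ _ _ hl' x y
          grind
      have e2 : r = r' := by
        refine ihr r' (a + 1 + l.numNodes) ?_
        funext x y
        by_cases hx : a + 1 + l.numNodes ≤ x ∧ a + 1 + l.numNodes ≤ y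
        · have := hl.glueRel_iff_right (τ := r.ncRel (a + 1 + l.numNodes)) (by omega) hx.1 hx.2
          rw [h, hl'.glueRel_iff_right (by omega) hx.1 hx.2] at this
          exact propext this.symm
        · have m1 := @IsNoncrossingRel.left_mem _ _ _ hr x y
          have m2 := @IsNoncrossingRel.left_mem _ _ _ hr' x y
          have m3 := @IsNoncrossingRel.right_mem _ _ _ hr x y
          have m4 := @IsNoncrossingRel.right_mem _ _ _ hr' x y
          grind
      rw [e1, e2]

theorem IsNoncrossingRel.exists_ncRel_eq {n a : ℕ} {r : ℕ → ℕ → Prop}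
    (h : IsNoncrossingRel a (a + n) r) :
    ∃ t : BinaryTree Unit, t.numNodes = n ∧ t.ncRel a = r := by
  induction n using Nat.strong_induction_on generalizing a r with
  | _ n ih =>
    rcases n.eq_zero_or_pos with rfl | hn
    · refine ⟨nil, rfl, ?_⟩
      funext x y
      have := @IsNoncrossingRel.left_mem _ _ _ h x y
      simp only [ncRel]
      grind
    · obtain ⟨m, σ, τ, ham, hmb, hσ, hτ, rfl⟩ := h.exists_eq_glueRel (by omega)
      obtain ⟨i, rfl⟩ := Nat.exists_eq_add_of_lt ham
      obtain ⟨j, hj⟩ := Nat.exists_eq_add_of_le hmb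
      have hj' : n = i + j + 1 := by omega
      rw [hj] at hτ
      obtain ⟨l, hl, rfl⟩ := ih i (by omega) (a := a + 1) (by convert hσ using 1; omega)
      obtain ⟨r, hr, rfl⟩ := ih j (by omega) hτ
      refine ⟨node () l r, by simp only [numNodes]; omega, ?_⟩
      simp only [ncRel, hl]
      rw [show a + 1 + i = a + i + 1 by omega]

/-- The size of the class of `x` under the relation `r`, restricted to `{0, …, M - 1}`. -/
noncomputable def classSize (M : ℕ) (r : ℕ → ℕ → Prop) (x : ℕ) : ℕ :=
  ((range M).filter fun y => r x y).card

namespace IsNoncrossingRel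

variable {a b m M : ℕ} {r σ τ : ℕ → ℕ → Prop}

theorem classSize_eq_of_rel (h : IsNoncrossingRel a b r) {x y : ℕ} (hxy : r x y) :
    classSize M r x = classSize M r y := by
  unfold classSize
  congr 1
  ext z
  have h1 := h.trans x y z hxy
  have h2 := h.trans y x z (h.symm _ _ hxy)
  simp only [mem_filter]
  tauto

theorem classSize_eq_zero (h : IsNoncrossingRel a b r) {x : ℕ} (hx : ¬ (a ≤ x ∧ x < b)) :
    classSize M r x = 0 := by
  unfold classSize
  rw [card_eq_zero, filter_eq_empty_iff]
  exact fun y _ hxy => hx (h.left_mem hxy)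

theorem classSize_glueRel_base (hσ : IsNoncrossingRel (a + 1) m σ) (hτ : IsNoncrossingRel m b τ)
    (ham : a < m) (hmb : m ≤ b) (hM : b ≤ M) :
    classSize M (glueRel a m σ τ) a = 1 + classSize M τ m := by
  have : (range M).filter (fun y => glueRel a m σ τ a y) =
      insert a ((range M).filter fun y => τ m y) := by
    ext y
    simp only [mem_filter, mem_insert, mem_range, hσ.glueRel_base_iff hτ ham]
    grind
  unfold classSize
  rw [this, card_insert_of_notMem, add_comm]
  intro ha
  have := hτ.right_mem (mem_filter.1 ha).2
  omega

theorem classSize_glueRel_left (hτ : IsNoncrossingRel m b τ)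
    {x : ℕ} (hx : a < x ∧ x < m) :
    classSize M (glueRel a m σ τ) x = classSize M σ x := by
  unfold classSize
  simp only [hτ.glueRel_iff_left hx]

theorem classSize_glueRel_right (hσ : IsNoncrossingRel (a + 1) m σ) (hτ : IsNoncrossingRel m b τ)
    (ham : a < m) {x : ℕ} (hx : m ≤ x) (hmx : ¬ τ m x) :
    classSize M (glueRel a m σ τ) x = classSize M τ x := by
  unfold classSize
  congr 1
  ext y
  have h1 := @left_mem _ _ _ hσ x y
  have h2 := hτ.symm x m
  simp only [mem_filter, glueRel]
  grind

theorem card_filter_classSize (h : IsNoncrossingRel a b r) (k : ℕ) :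
    ((range M).filter fun x => classSize M r x = k).card =
      (if classSize M r a = k then k else 0) +
        ((range M).filter fun x => ¬ r a x ∧ classSize M r x = k).card := by
  rw [← card_filter_add_card_filter_not (s := (range M).filter fun x => classSize M r x = k)
    (fun x => r a x), filter_filter, filter_filter]
  congr 1
  · split_ifs with hk
    · conv_rhs => rw [← hk]
      rw [classSize]
      congr 1
      refine filter_congr fun x _ => ⟨fun hx => hx.2, fun hx => ⟨?_, hx⟩⟩
      rw [← h.classSize_eq_of_rel hx, hk]
    · rw [card_eq_zero, filter_eq_empty_iff]
      exact fun x _ hx => hk (by rw [h.classSize_eq_of_rel hx.2, hx.1])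
  · simp only [and_comm]

theorem card_filter_classSize_glueRel (hσ : IsNoncrossingRel (a + 1) m σ)
    (hτ : IsNoncrossingRel m b τ) (ham : a < m) (hmb : m ≤ b) {k : ℕ} (hk : 1 ≤ k) :
    ((range M).filter fun x => ¬ glueRel a m σ τ a x ∧ classSize M (glueRel a m σ τ) x = k).card =
      ((range M).filter fun x => classSize M σ x = k).card +
        ((range M).filter fun x => ¬ τ m x ∧ classSize M τ x = k).card := by
  rw [← card_union_of_disjoint]
  · congr 1
    ext x
    have h1 := @classSize_eq_zero _ _ M _ hσ x
    have h2 := @classSize_eq_zero _ _ M _ hτ x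
    have h3 := @classSize_eq_zero _ _ M _ (hσ.glue hτ ham hmb) x
    have h4 := @classSize_glueRel_left a b m M σ τ hτ x
    have h5 := @classSize_glueRel_right _ _ _ M _ _ hσ hτ ham x
    have h6 := @right_mem _ _ _ hτ m x
    simp only [mem_filter, mem_union, hσ.glueRel_base_iff hτ ham]
    grind
  · rw [disjoint_filter]
    intro x _ hx hx'
    have h1 := @classSize_eq_zero _ _ M _ hσ x
    have h2 := @classSize_eq_zero _ _ M _ hτ x
    grind

end IsNoncrossingRel

namespace BinaryTree

/-- The size of the class of the root in the noncrossing relation encoded by a tree. -/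
def rootClassSize : BinaryTree Unit → ℕ
  | .nil => 0
  | .node _ _ r => 1 + r.rootClassSize

/-- The number of elements outside the class of the root which lie in a class of size `k`. -/
def nonrootCount (k : ℕ) : BinaryTree Unit → ℕ
  | .nil => 0
  | .node _ l r =>
    (if l.rootClassSize = k then k else 0) + l.nonrootCount k + r.nonrootCount k

variable {M : ℕ}

theorem classSize_ncRel (t : BinaryTree Unit) {a : ℕ} (hM : a + t.numNodes ≤ M) :
    classSize M (t.ncRel a) a = t.rootClassSize := by
  induction t generalizing a with
  | nil =>
    rw [ncRel_nil]
    simp [classSize, rootClassSize]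
  | node u l r ihl ihr =>
    simp only [numNodes] at hM
    rw [ncRel_node, rootClassSize, (l.isNoncrossingRel_ncRel (a + 1)).classSize_glueRel_base
      (r.isNoncrossingRel_ncRel (a + 1 + l.numNodes)) (by omega) (by omega) (by omega),
      ihr (by omega)]

theorem card_filter_nonroot (t : BinaryTree Unit) {a k : ℕ} (hk : 1 ≤ k)
    (hM : a + t.numNodes ≤ M) :
    ((range M).filter fun x => ¬ t.ncRel a a x ∧ classSize M (t.ncRel a) x = k).card =
      t.nonrootCount k := by
  induction t generalizing a with
  | nil =>
    rw [nonrootCount, card_eq_zero, filter_eq_empty_iff]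
    rintro x - ⟨-, hx⟩
    rw [(isNoncrossingRel_ncRel nil a).classSize_eq_zero (by simp [numNodes])] at hx
    omega
  | node u l r ihl ihr =>
    simp only [numNodes] at hM
    rw [ncRel_node, nonrootCount, (l.isNoncrossingRel_ncRel (a + 1)).card_filter_classSize_glueRel
      (r.isNoncrossingRel_ncRel (a + 1 + l.numNodes)) (by omega) (by omega) hk,
      ihr (by omega), (l.isNoncrossingRel_ncRel (a + 1)).card_filter_classSize,
      ihl (by omega), classSize_ncRel _ (by omega)]

theorem card_filter_classSize_ncRel (t : BinaryTree Unit) {a k : ℕ} (hk : 1 ≤ k)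
    (hM : a + t.numNodes ≤ M) :
    ((range M).filter fun x => classSize M (t.ncRel a) x = k).card =
      (if t.rootClassSize = k then k else 0) + t.nonrootCount k := by
  rw [(t.isNoncrossingRel_ncRel a).card_filter_classSize, card_filter_nonroot _ hk hM,
    classSize_ncRel _ hM]

/-- The ordinary generating function of the weight `f` on binary trees counted by nodes. -/
noncomputable def weightSeries (f : BinaryTree Unit → ℚ) : ℚ⟦X⟧ :=
  PowerSeries.mk fun n => ∑ t ∈ treesOfNumNodesEq n, f t

theorem weightSeries_add (f g : BinaryTree Unit → ℚ) :
    weightSeries (fun t => f t + g t) = weightSeries f + weightSeries g := by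
  ext n
  simp [weightSeries, sum_add_distrib]

theorem weightSeries_eq_of_node {f g h : BinaryTree Unit → ℚ}
    (hf : ∀ l r, f (node () l r) = g l * h r) :
    weightSeries f = PowerSeries.C (f nil) + X * (weightSeries g * weightSeries h) := by
  ext n
  cases n with
  | zero => simp [weightSeries]
  | succ n =>
    rw [map_add, coeff_succ_X_mul, coeff_mul, PowerSeries.coeff_C, if_neg n.succ_ne_zero, zero_add]
    simp only [weightSeries, coeff_mk]
    rw [treesOfNumNodesEq_succ, sum_biUnion]
    · refine sum_congr rfl fun ij _ => ?_
      rw [sum_map, sum_product, sum_mul_sum]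
      exact sum_congr rfl fun l _ => sum_congr rfl fun r _ => hf l r
    · simp_rw [Set.PairwiseDisjoint, Set.Pairwise, disjoint_left]
      aesop

theorem weightSeries_one : weightSeries (fun _ => 1) = PowerSeries.mk fun n => (catalan n : ℚ) := by
  ext n
  simp [weightSeries, treesOfNumNodesEq_card_eq_catalan]

theorem weightSeries_rootClassSize (k : ℕ) :
    weightSeries (fun t => if t.rootClassSize = k then 1 else 0) =
      (X * weightSeries fun _ => 1) ^ k := by
  induction k with
  | zero =>
    rw [weightSeries_eq_of_node (g := fun _ => 0) (h := fun _ => 0)]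
    · have : weightSeries (fun _ => 0) = 0 := by ext; simp [weightSeries]
      simp [rootClassSize, this]
    · simp [rootClassSize]
  | succ k ih =>
    rw [weightSeries_eq_of_node (g := fun _ => 1)
      (h := fun t => if t.rootClassSize = k then 1 else 0), ih]
    · simp [rootClassSize]
      ring
    · intro l r
      simp [rootClassSize, add_comm 1]

theorem weightSeries_classSize (k : ℕ) :
    (2 - weightSeries fun _ => 1) * weightSeries (fun t =>
      (((if t.rootClassSize = k then k else 0) + t.nonrootCount k : ℕ) : ℚ)) =
      PowerSeries.C (k : ℚ) * (X * weightSeries fun _ => 1) ^ k := by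
  set p : BinaryTree Unit → ℚ := fun t =>
    (((if t.rootClassSize = k then k else 0) + t.nonrootCount k : ℕ) : ℚ) with hp
  set c := weightSeries fun _ => 1
  set d := weightSeries fun t => (t.nonrootCount k : ℚ)
  have hc : c = 1 + X * (c * c) := by
    simpa using weightSeries_eq_of_node (f := fun _ => 1) (g := fun _ => 1) (h := fun _ => 1)
      (by simp)
  have hpd : weightSeries p = PowerSeries.C (k : ℚ) * (X * c) ^ k + d := by
    rw [← weightSeries_rootClassSize]
    ext n
    simp only [map_add, coeff_C_mul, weightSeries, d, hp, coeff_mk, Nat.cast_add, sum_add_distrib,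
      mul_sum]
    simp
  have hd : d = X * (weightSeries p * c) + X * (c * d) := by
    have e : (fun t : BinaryTree Unit => (t.nonrootCount k : ℚ)) =
        fun t => (if t = nil then 0 else p t.left) +
          (if t = nil then 0 else (t.right.nonrootCount k : ℚ)) := by
      funext t
      cases t <;> simp [nonrootCount, left, right, hp]
    have e1 := weightSeries_eq_of_node (f := fun t => if t = nil then 0 else p t.left)
      (g := p) (h := fun _ => 1) (by simp [left])
    have e2 := weightSeries_eq_of_node
      (f := fun t => if t = nil then 0 else (t.right.nonrootCount k : ℚ))
      (g := fun _ => 1) (h := fun t => (t.nonrootCount k : ℚ)) (by simp [right])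
    simp only [if_true, map_zero, zero_add] at e1 e2
    rw [← e1, ← e2, ← weightSeries_add, ← e]
  rw [hpd] at hd ⊢
  linear_combination c * hd - (PowerSeries.C (k : ℚ) * (X * c) ^ k + 2 * d) * hc

end BinaryTree

/-- The finpartition of `Fin n` into the classes of a noncrossing relation on `[0, n)`. -/
noncomputable def IsNoncrossingRel.toFinpartition {n : ℕ} {r : ℕ → ℕ → Prop}
    (h : IsNoncrossingRel 0 n r) : Finpartition (univ : Finset (Fin n)) :=
  Finpartition.ofSetoid
    { r := fun x y => r x y
      iseqv := ⟨fun x => (h.dom x).2 ⟨Nat.zero_le _, x.2⟩, fun hxy => h.symm _ _ hxy,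
        fun hxy hyz => h.trans _ _ _ hxy hyz⟩ }

theorem IsNoncrossingRel.mem_part_toFinpartition {n : ℕ} {r : ℕ → ℕ → Prop}
    (h : IsNoncrossingRel 0 n r) {x y : Fin n} : y ∈ h.toFinpartition.part x ↔ r x y :=
  Finpartition.mem_part_ofSetoid_iff_rel

namespace Finpartition

variable {n : ℕ} {π π' : Finpartition (univ : Finset (Fin n))}

theorem eq_of_mem_part_iff (h : ∀ x y, y ∈ π.part x ↔ y ∈ π'.part x) : π = π' := by
  have h' : ∀ x, π.part x = π'.part x := fun x => Finset.ext (h x)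
  ext p
  constructor
  · intro hp
    obtain ⟨x, hx⟩ := π.nonempty_of_mem_parts hp
    rw [← π.part_eq_of_mem hp hx, h']
    exact π'.part_mem.2 (mem_univ x)
  · intro hp
    obtain ⟨x, hx⟩ := π'.nonempty_of_mem_parts hp
    rw [← π'.part_eq_of_mem hp hx, ← h']
    exact π.part_mem.2 (mem_univ x)

theorem isNoncrossing_iff : IsNoncrossing π ↔ ∀ i j k l : Fin n,
    i < j → j < k → k < l → k ∈ π.part i → l ∈ π.part j → j ∈ π.part i := by
  constructor
  · intro h i j k l hij hjk hkl hik hjl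
    rw [h (π.part i) (π.part_mem.2 (mem_univ i)) (π.part j) (π.part_mem.2 (mem_univ j)) i j k l
      hij hjk hkl (π.mem_part (mem_univ i)) hik (π.mem_part (mem_univ j)) hjl]
    exact π.mem_part (mem_univ j)
  · intro h p hp q hq i j k l hij hjk hkl hi hk hj hl
    have hj' := h i j k l hij hjk hkl (by rwa [π.part_eq_of_mem hp hi])
      (by rwa [π.part_eq_of_mem hq hj])
    rw [π.part_eq_of_mem hp hi] at hj'
    exact π.eq_of_mem_parts hp hq hj' hj

theorem exists_toFinpartition_eq (h : IsNoncrossing π) :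
    ∃ (r : ℕ → ℕ → Prop) (hr : IsNoncrossingRel 0 n r), hr.toFinpartition = π := by
  have hs : ∀ x y, y ∈ π.part x → x ∈ π.part y := fun x y hxy => by
    rw [mem_part_iff_exists] at hxy ⊢
    tauto
  have ht : ∀ x y z, y ∈ π.part x → z ∈ π.part y → z ∈ π.part x := fun x y z hxy hyz => by
    rwa [← π.part_eq_of_mem (π.part_mem.2 (mem_univ x)) hxy]
  rw [isNoncrossing_iff] at h
  have hr : IsNoncrossingRel 0 n
      fun x y => ∃ (hx : x < n) (hy : y < n), (⟨y, hy⟩ : Fin n) ∈ π.part ⟨x, hx⟩ := by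
    constructor
    · rintro x y ⟨hx, hy, hxy⟩
      exact ⟨hy, hx, hs _ _ hxy⟩
    · rintro x y z ⟨hx, hy, hxy⟩ ⟨_, hz, hyz⟩
      exact ⟨hx, hz, ht _ _ _ hxy hyz⟩
    · exact fun x => ⟨fun ⟨hx, _⟩ => ⟨Nat.zero_le _, hx⟩,
        fun hx => ⟨hx.2, hx.2, π.mem_part (mem_univ _)⟩⟩
    · rintro i j k l hij hjk hkl ⟨hi, hk, hik⟩ ⟨hj, hl, hjl⟩
      exact ⟨hi, hj, h _ _ _ _ (Fin.mk_lt_mk.2 hij) (Fin.mk_lt_mk.2 hjk) (Fin.mk_lt_mk.2 hkl)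
        hik hjl⟩
  refine ⟨_, hr, eq_of_mem_part_iff fun x y => ?_⟩
  rw [hr.mem_part_toFinpartition]
  exact ⟨fun ⟨_, _, hxy⟩ => hxy, fun hxy => ⟨x.2, y.2, hxy⟩⟩

theorem card_filter_parts_mul (π : Finpartition (univ : Finset (Fin n))) (k : ℕ) :
    (π.parts.filter fun p => p.card = k).card * k =
      (univ.filter fun x => (π.part x).card = k).card := by
  rw [card_eq_sum_card_fiberwise (f := π.part) (t := π.parts.filter fun p => p.card = k)]
  · rw [← smul_eq_mul, ← sum_const]
    refine sum_congr rfl fun p hp => ?_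
    obtain ⟨hp, hk⟩ := mem_filter.1 hp
    rw [← hk]
    congr 1
    ext x
    simp only [mem_filter, mem_univ, true_and, π.part_eq_iff_mem hp]
    refine ⟨fun hx => ⟨by rw [π.part_eq_of_mem hp hx], hx⟩, fun hx => hx.2⟩
  · intro x hx
    simpa using hx

end Finpartition

theorem Fin.card_filter_univ_val (n : ℕ) (p : ℕ → Prop) :
    (univ.filter fun x : Fin n => p x).card = ((range n).filter p).card := by
  rw [← Nat.Iio_eq_range, ← Fin.map_valEmbedding_univ, filter_map, card_map]
  rfl

namespace IsNoncrossingRel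

variable {n : ℕ} {r : ℕ → ℕ → Prop}

theorem isNoncrossing_toFinpartition (h : IsNoncrossingRel 0 n r) :
    IsNoncrossing h.toFinpartition := by
  rw [Finpartition.isNoncrossing_iff]
  simp only [h.mem_part_toFinpartition]
  exact fun i j k l hij hjk hkl => h.noncrossing i j k l hij hjk hkl

theorem eq_of_toFinpartition_eq {r' : ℕ → ℕ → Prop} (h : IsNoncrossingRel 0 n r)
    (h' : IsNoncrossingRel 0 n r') (e : h.toFinpartition = h'.toFinpartition) : r = r' := by
  funext x y
  by_cases hxy : x < n ∧ y < n
  · have := h.mem_part_toFinpartition (x := ⟨x, hxy.1⟩) (y := ⟨y, hxy.2⟩)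
    rw [e, h'.mem_part_toFinpartition] at this
    exact propext this.symm
  · have h1 := @left_mem _ _ _ h x y
    have h2 := @left_mem _ _ _ h' x y
    have h3 := @right_mem _ _ _ h x y
    have h4 := @right_mem _ _ _ h' x y
    grind

theorem card_part_toFinpartition (h : IsNoncrossingRel 0 n r) (x : Fin n) :
    (h.toFinpartition.part x).card = classSize n r x := by
  rw [classSize, ← Fin.card_filter_univ_val]
  congr 1
  ext y
  simp [h.mem_part_toFinpartition]

theorem card_filter_parts_toFinpartition (h : IsNoncrossingRel 0 n r) (k : ℕ) :
    (h.toFinpartition.parts.filter fun p => p.card = k).card * k =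
      ((range n).filter fun x => classSize n r x = k).card := by
  rw [Finpartition.card_filter_parts_mul]
  simp only [h.card_part_toFinpartition]
  convert Fin.card_filter_univ_val n fun x => classSize n r x = k

end IsNoncrossingRel

theorem blockCount_mul (n : ℕ) {k : ℕ} (hk : 1 ≤ k) :
    blockCount n k * k = ∑ t ∈ treesOfNumNodesEq n,
      ((if t.rootClassSize = k then k else 0) + t.nonrootCount k) := by
  have hrel : ∀ t ∈ treesOfNumNodesEq n, IsNoncrossingRel 0 n (t.ncRel 0) := fun t ht => by
    simpa [mem_treesOfNumNodesEq.1 ht] using t.isNoncrossingRel_ncRel 0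
  rw [blockCount, sum_mul]
  symm
  refine sum_bij (fun t ht => (hrel t ht).toFinpartition) ?_ ?_ ?_ ?_
  · exact fun t ht => mem_filter.2 ⟨mem_univ _, (hrel t ht).isNoncrossing_toFinpartition⟩
  · exact fun t ht t' ht' e =>
      ncRel_injective t t' 0 ((hrel t ht).eq_of_toFinpartition_eq (hrel t' ht') e)
  · intro π hπ
    obtain ⟨r, hr, rfl⟩ := Finpartition.exists_toFinpartition_eq (mem_filter.1 hπ).2
    obtain ⟨t, ht, rfl⟩ := IsNoncrossingRel.exists_ncRel_eq (n := n) (a := 0) (by simpa using hr)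
    exact ⟨t, mem_treesOfNumNodesEq.2 ht, rfl⟩
  · intro t ht
    rw [(hrel t ht).card_filter_parts_toFinpartition,
      card_filter_classSize_ncRel t hk (by simp [mem_treesOfNumNodesEq.1 ht])]

theorem blockCount_eq_zero_of_lt {n k : ℕ} (h : n < k) : blockCount n k = 0 := by
  refine sum_eq_zero fun π _ => ?_
  rw [card_eq_zero, filter_eq_empty_iff]
  intro p _ hp
  have := p.card_le_univ
  rw [Fintype.card_fin] at this
  omega

/-- **Generating function for block counts.**  For `k ≥ 1`, with
`C(z) = ∑_{n ≥ 0} Cat_n zⁿ` the Catalan generating series and `a_{n,k}` the number of blocks of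
size `k` over all noncrossing partitions of `{1,…,n}`, one has
`(2 − C(z)) · ∑_{n ≥ k} a_{n,k} zⁿ = z^k C(z)^k` as formal power series over `ℚ`. -/
theorem blockCount_generating_function (k : ℕ) (hk : 1 ≤ k) :
    (2 - PowerSeries.mk fun n => (catalan n : ℚ)) *
        PowerSeries.mk (fun n => if k ≤ n then (blockCount n k : ℚ) else 0) =
      PowerSeries.X ^ k * (PowerSeries.mk fun n => (catalan n : ℚ)) ^ k := by
  have hk0 : (k : ℚ) ≠ 0 := by exact_mod_cast (by omega : k ≠ 0)
  have hC : PowerSeries.C (k : ℚ) ≠ 0 := by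
    rwa [Ne, map_eq_zero_iff _ PowerSeries.C_injective]
  have key : PowerSeries.C (k : ℚ) *
      PowerSeries.mk (fun n => if k ≤ n then (blockCount n k : ℚ) else 0) =
      weightSeries (fun t =>
        (((if t.rootClassSize = k then k else 0) + t.nonrootCount k : ℕ) : ℚ)) := by
    ext n
    rw [coeff_C_mul, weightSeries, coeff_mk, coeff_mk, ← Nat.cast_sum, ← blockCount_mul n hk]
    split_ifs with h
    · push_cast
      ring
    · simp [blockCount_eq_zero_of_lt (not_le.1 h)]
  have h := weightSeries_classSize k
  rw [← key, weightSeries_one, mul_pow] at h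
  refine mul_left_cancel₀ hC ?_
  linear_combination h
end
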